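/- arXiv:2604.14416 — 3 statements merged into one kernel-verified Lean document; each statement's English description precedes it below -/
import Mathlib

section
/- Let ι be a finite nonempty type and T : Matrix ι ι ℝ a matrix with nonnegative entries. Suppose v : ι → ℝ has all entries strictly positive and satisfies T·v = λ·v for some λ ∈ ℝ. Then every complex eigenvalue μ of T (i.e., every eigenvalue of the complexification of T) satisfies ‖μ‖ ≤ λ. -/
/-- **Perron–Frobenius upper bound.**  Let `ι` be a finite nonempty type and
`T : Matrix ι ι ℝ` entrywise nonnegative.  If `v` is entrywise positive with
`T·v = l·v`, then every complex eigenvalue `μ` of the complexification of `T`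
satisfies `‖μ‖ ≤ l`. -/
theorem complex_eigenvalue_le_perron
    {ι : Type*} [Fintype ι] [Nonempty ι]
    (T : Matrix ι ι ℝ) (hT : ∀ i j, 0 ≤ T i j)
    (v : ι → ℝ) (hv : ∀ i, 0 < v i) (l : ℝ) (heig : T.mulVec v = l • v) :
    ∀ μ : ℂ, (∃ w : ι → ℂ, w ≠ 0 ∧ (T.map (fun x : ℝ => (x : ℂ))).mulVec w = μ • w) →
      ‖μ‖ ≤ l := by
  rintro μ ⟨w, hw, hμ⟩
  -- Compare `w` with `v` at an index maximizing `‖w i‖ / v i`.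
  obtain ⟨i, hi⟩ := Finite.exists_max fun j => ‖w j‖ / v j
  have hle : ∀ j, ‖w j‖ ≤ ‖w i‖ / v i * v j := fun j => (div_le_iff₀ (hv j)).mp (hi j)
  have hwi : 0 < ‖w i‖ := by
    obtain ⟨k, hk⟩ := Function.ne_iff.mp hw
    have hpos : 0 < ‖w i‖ / v i := (div_pos (norm_pos_iff.mpr hk) (hv k)).trans_le (hi k)
    exact (div_pos_iff_of_pos_right (hv i)).mp hpos
  have hwsum : ∑ j, (T i j : ℂ) * w j = μ * w i := congrFun hμ i
  have hvsum : ∑ j, T i j * v j = l * v i := congrFun heig i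
  refine le_of_mul_le_mul_right ?_ hwi
  calc ‖μ‖ * ‖w i‖ = ‖∑ j, (T i j : ℂ) * w j‖ := by rw [hwsum, norm_mul]
    _ ≤ ∑ j, ‖(T i j : ℂ) * w j‖ := norm_sum_le _ _
    _ = ∑ j, T i j * ‖w j‖ := by simp [abs_of_nonneg (hT i _)]
    _ ≤ ∑ j, T i j * (‖w i‖ / v i * v j) :=
      Finset.sum_le_sum fun j _ => mul_le_mul_of_nonneg_left (hle j) (hT i j)
    _ = ‖w i‖ / v i * ∑ j, T i j * v j := by
      simp only [Finset.mul_sum, mul_left_comm]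
    _ = l * ‖w i‖ := by
      rw [hvsum, mul_left_comm, div_mul_cancel₀ _ (hv i).ne']
end

section
/- The Galois group of the polynomial f_anom = X⁴ − 5X³ − 29X² + 47X + 42 over ℚ (i.e., the Galois group of its splitting field over ℚ) is isomorphic to the symmetric group S₄; in particular, its splitting field has degree 24 over ℚ. -/
open Polynomial

section Quartic

variable {F : Type*} [Field F]

/-- Monic quartics are equal exactly when their coefficients are. -/
theorem quartic_coeff_eq {R : Type*} [CommRing R] {a b c d a' b' c' d' : R}
    (h : X ^ 4 + C a * X ^ 3 + C b * X ^ 2 + C c * X + C d =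
      X ^ 4 + C a' * X ^ 3 + C b' * X ^ 2 + C c' * X + C d') :
    a = a' ∧ b = b' ∧ c = c' ∧ d = d' := by
  refine ⟨?_, ?_, ?_, ?_⟩
  · simpa [coeff_X, coeff_C] using congrArg (coeff · 3) h
  · simpa [coeff_X, coeff_C] using congrArg (coeff · 2) h
  · simpa [coeff_X, coeff_C] using congrArg (coeff · 1) h
  · simpa [coeff_X, coeff_C] using congrArg (coeff · 0) h

/-- Vieta's formulas for a monic quartic. -/
theorem quartic_vieta {R : Type*} [CommRing R] {a b c d : R} (r : Fin 4 → R)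
    (h : X ^ 4 + C a * X ^ 3 + C b * X ^ 2 + C c * X + C d =
      (X - C (r 0)) * (X - C (r 1)) * (X - C (r 2)) * (X - C (r 3))) :
    a = -(r 0 + r 1 + r 2 + r 3) ∧
    b = r 0 * r 1 + r 0 * r 2 + r 0 * r 3 + r 1 * r 2 + r 1 * r 3 + r 2 * r 3 ∧
    c = -(r 0 * r 1 * r 2 + r 0 * r 1 * r 3 + r 0 * r 2 * r 3 + r 1 * r 2 * r 3) ∧
    d = r 0 * r 1 * r 2 * r 3 := by
  apply quartic_coeff_eq
  rw [h]
  simp only [map_add, map_mul, map_neg]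
  ring

/-- The discriminant of the monic quartic `X ^ 4 + a X ^ 3 + b X ^ 2 + c X + d`. -/
def quarticDiscr {R : Type*} [CommRing R] (a b c d : R) : R :=
  256 * d ^ 3 - 192 * a * c * d ^ 2 - 128 * b ^ 2 * d ^ 2 + 144 * b * c ^ 2 * d - 27 * c ^ 4
    + 144 * a ^ 2 * b * d ^ 2 - 6 * a ^ 2 * c ^ 2 * d - 80 * a * b ^ 2 * c * d
    + 18 * a * b * c ^ 3 + 16 * b ^ 4 * d - 4 * b ^ 3 * c ^ 2 - 27 * a ^ 4 * d ^ 2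
    + 18 * a ^ 3 * b * c * d - 4 * a ^ 3 * c ^ 3 - 4 * a ^ 2 * b ^ 3 * d + a ^ 2 * b ^ 2 * c ^ 2

/-- The resolvent cubic of the monic quartic `X ^ 4 + a X ^ 3 + b X ^ 2 + c X + d`. -/
noncomputable def resolventCubic {R : Type*} [CommRing R] (a b c d : R) : R[X] :=
  X ^ 3 + C (-b) * X ^ 2 + C (a * c - 4 * d) * X + C (4 * b * d - a ^ 2 * d - c ^ 2)

theorem map_quarticDiscr {R S : Type*} [CommRing R] [CommRing S] (f : R →+* S) (a b c d : R) :
    f (quarticDiscr a b c d) = quarticDiscr (f a) (f b) (f c) (f d) := by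
  simp only [quarticDiscr, map_add, map_sub, map_mul, map_pow, map_ofNat]

theorem det_vandermonde_sq_eq_quarticDiscr {R : Type*} [CommRing R] {a b c d : R} {r : Fin 4 → R}
    (h : X ^ 4 + C a * X ^ 3 + C b * X ^ 2 + C c * X + C d =
      (X - C (r 0)) * (X - C (r 1)) * (X - C (r 2)) * (X - C (r 3))) :
    (Matrix.vandermonde r).det ^ 2 = quarticDiscr a b c d := by
  obtain ⟨rfl, rfl, rfl, rfl⟩ := quartic_vieta r h
  have hv : (Matrix.vandermonde r).det = (r 1 - r 0) * (r 2 - r 0) * (r 3 - r 0) *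
      (r 2 - r 1) * (r 3 - r 1) * (r 3 - r 2) := by
    rw [Matrix.det_vandermonde]
    have h0 : Finset.Ioi (0 : Fin 4) = {1, 2, 3} := by decide
    have h1 : Finset.Ioi (1 : Fin 4) = {2, 3} := by decide
    have h2 : Finset.Ioi (2 : Fin 4) = {3} := by decide
    have h3 : Finset.Ioi (3 : Fin 4) = ∅ := by decide
    rw [Fin.prod_univ_four, h0, h1, h2, h3]
    simp
    ring
  rw [hv, quarticDiscr]
  ring

theorem aeval_resolventCubic {R A : Type*} [CommRing R] [CommRing A] [Algebra R A]
    {a b c d : R} {r : Fin 4 → A}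
    (h : X ^ 4 + C (algebraMap R A a) * X ^ 3 + C (algebraMap R A b) * X ^ 2 +
      C (algebraMap R A c) * X + C (algebraMap R A d) =
      (X - C (r 0)) * (X - C (r 1)) * (X - C (r 2)) * (X - C (r 3))) :
    aeval (r 0 * r 1 + r 2 * r 3) (resolventCubic a b c d) = 0 := by
  obtain ⟨ha, hb, hc, hd⟩ := quartic_vieta r h
  simp only [resolventCubic, map_add, map_mul, map_sub, map_neg, map_pow, aeval_X, aeval_C,
    map_ofNat, ha, hb, hc, hd]
  ring

theorem Matrix.vandermonde_comp_det {R : Type*} [CommRing R] {n : ℕ} (v : Fin n → R)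
    (π : Equiv.Perm (Fin n)) :
    (Matrix.vandermonde (v ∘ π)).det = Equiv.Perm.sign π * (Matrix.vandermonde v).det := by
  rw [← Matrix.det_permute]
  rfl

/-- If `p` is irreducible and `x` is a root of `p` in `L`, then `deg p` divides `[L : F]`. -/
theorem Irreducible.natDegree_dvd_finrank {L : Type*} [Field L] [Algebra F L]
    [FiniteDimensional F L] {p : F[X]} (hp : Irreducible p) {x : L} (hx : aeval x p = 0) :
    p.natDegree ∣ Module.finrank F L := by
  have h := minpoly.degree_dvd (K := F) (x := x) (Algebra.IsIntegral.isIntegral x)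
  rwa [← minpoly.eq_of_irreducible hp hx,
    natDegree_mul_C (inv_ne_zero (leadingCoeff_ne_zero.mpr hp.ne_zero))] at h

/-- An irreducible quartic whose resolvent cubic is irreducible and whose discriminant is not a
square has Galois group `S₄`. -/
theorem quartic_gal_mulEquiv_perm {p : F[X]} {a b c d : F}
    (hp : p = X ^ 4 + C a * X ^ 3 + C b * X ^ 2 + C c * X + C d) (hirr : Irreducible p)
    (hres : Irreducible (resolventCubic a b c d)) (hdisc : ¬ IsSquare (quarticDiscr a b c d)) :
    Nonempty (p.Gal ≃* Equiv.Perm (Fin 4)) ∧ Module.finrank F p.SplittingField = 24 := by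
  have hdeg : p.natDegree = 4 := by rw [hp]; compute_degree!
  have hmonic : p.Monic := by rw [hp]; monicity!
  have hdeg' : (resolventCubic a b c d).natDegree = 3 := by
    rw [resolventCubic]; compute_degree!
  have hsplit := SplittingField.splits p
  obtain ⟨r, hr⟩ : ∃ r : Fin 4 → p.SplittingField, p.map (algebraMap F p.SplittingField) =
      (X - C (r 0)) * (X - C (r 1)) * (X - C (r 2)) * (X - C (r 3)) := by
    have hcard := hsplit.natDegree_eq_card_roots
    have hprod := hsplit.eq_prod_roots_of_monic (hmonic.map _)
    rw [natDegree_map, hdeg] at hcard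
    obtain ⟨l, hl⟩ := Quot.exists_rep (p.map (algebraMap F p.SplittingField)).roots
    rw [← hl] at hprod hcard
    obtain ⟨x, y, z, w, rfl⟩ := List.length_eq_four.mp hcard.symm
    exact ⟨![x, y, z, w], by simpa [mul_assoc] using hprod⟩
  have hfac := hr
  simp only [hp, Polynomial.map_add, Polynomial.map_mul, Polynomial.map_pow, map_X, map_C] at hfac
  have hdet := det_vandermonde_sq_eq_quarticDiscr hfac
  rw [← map_quarticDiscr] at hdet
  have hdet0 : (Matrix.vandermonde r).det ≠ 0 := by
    intro h0
    rw [h0, zero_pow two_ne_zero, eq_comm, map_eq_zero] at hdet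
    exact hdisc (hdet ▸ IsSquare.zero)
  have hinj : Function.Injective r := Matrix.det_vandermonde_ne_zero_iff.mp hdet0
  have hroot (x : p.SplittingField) : aeval x p = 0 ↔ ∃ i, r i = x := by
    rw [← eval_map_algebraMap, hr]
    simp [Fin.exists_fin_succ, sub_eq_zero, or_assoc, eq_comm]
  have hsep : p.Separable := by
    rw [← separable_map (algebraMap F p.SplittingField), hr]
    have := separable_prod_X_sub_C_iff.mpr hinj
    rwa [Fin.prod_univ_four] at this
  have hgal : IsGalois F p.SplittingField := IsGalois.of_separable_splitting_field hsep
  have hperm (σ : Gal(p.SplittingField/F)) : ∃ π : Equiv.Perm (Fin 4), ∀ i, σ (r i) = r (π i) := by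
    have h (i : Fin 4) : ∃ j, r j = σ (r i) := by
      rw [← hroot, aeval_algHom_apply, (hroot (r i)).mpr ⟨i, rfl⟩, map_zero]
    choose π hπ using h
    have hπ_inj : Function.Injective π := fun i j hij ↦
      hinj (σ.injective (by rw [← hπ, ← hπ, hij]))
    exact ⟨Equiv.ofBijective π hπ_inj.bijective_of_finite, fun i ↦ (hπ i).symm⟩
  choose φ hφ using hperm
  let Φ : Gal(p.SplittingField/F) →* Equiv.Perm (Fin 4) := MonoidHom.mk' φ fun σ τ ↦ by
    ext1 i
    apply hinj
    rw [Equiv.Perm.mul_apply, ← hφ, ← hφ, ← hφ]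
    rfl
  have hΦ : Function.Injective Φ := by
    intro σ τ h
    refine Gal.ext p fun x hx ↦ ?_
    obtain ⟨i, rfl⟩ := (hroot x).mp (aeval_eq_zero_of_mem_rootSet hx)
    exact (hφ σ i).trans <|
      (congrArg (fun π : Equiv.Perm (Fin 4) ↦ r (π i)) h).trans (hφ τ i).symm
  have hcard : Nat.card Φ.range = Module.finrank F p.SplittingField := by
    rw [← Gal.card_of_separable hsep]
    exact Nat.card_congr (MonoidHom.ofInjective hΦ).symm.toEquiv
  have h4 : 4 ∣ Module.finrank F p.SplittingField :=
    hdeg ▸ hirr.natDegree_dvd_finrank ((hroot (r 0)).mpr ⟨0, rfl⟩)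
  have h3 : 3 ∣ Module.finrank F p.SplittingField :=
    hdeg' ▸ hres.natDegree_dvd_finrank (aeval_resolventCubic hfac)
  have hindex := Φ.range.card_mul_index
  rw [Nat.card_eq_fintype_card (α := Equiv.Perm (Fin 4)), Fintype.card_perm, Fintype.card_fin,
    hcard, show Nat.factorial 4 = 24 from rfl] at hindex
  have hindex2 : Φ.range.index ≠ 2 := by
    intro h2
    have halt := Equiv.Perm.eq_alternatingGroup_of_index_eq_two h2
    have hfix (σ : Gal(p.SplittingField/F)) : σ (Matrix.vandermonde r).det = (Matrix.vandermonde r).det := by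
      have hsign : Equiv.Perm.sign (φ σ) = 1 := by
        rw [← Equiv.Perm.mem_alternatingGroup, ← halt]
        exact ⟨σ, rfl⟩
      have hmap : σ (Matrix.vandermonde r).det = (Matrix.vandermonde (r ∘ φ σ)).det := by
        rw [AlgEquiv.map_det]
        congr 1
        ext i j
        simp [Matrix.vandermonde_apply, hφ]
      rw [hmap, Matrix.vandermonde_comp_det, hsign]
      simp
    obtain ⟨δ, hδ⟩ := (IsGalois.mem_bot_iff_fixed _).mpr hfix
    refine hdisc ⟨δ, (algebraMap F p.SplittingField).injective ?_⟩
    rw [← hdet, ← hδ, map_mul, sq]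
    rfl
  have hdeg24 : Module.finrank F p.SplittingField = 24 := by
    obtain ⟨k, hk⟩ : 12 ∣ Module.finrank F p.SplittingField :=
      Nat.Coprime.mul_dvd_of_dvd_of_dvd (by norm_num : Nat.Coprime 4 3) h4 h3
    rw [hk] at hindex ⊢
    have hk2 : k * Φ.range.index = 2 := by linarith
    have hk' : k ∣ 2 := ⟨_, hk2.symm⟩
    have : k = 1 ∨ k = 2 := (Nat.dvd_prime Nat.prime_two).mp hk'
    rcases this with rfl | rfl
    · exact absurd (by simpa using hk2) hindex2
    · rfl
  have hsurj : Function.Surjective Φ := by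
    rw [← MonoidHom.range_eq_top, ← Subgroup.index_eq_one]
    rw [hdeg24] at hindex
    omega
  exact ⟨⟨MulEquiv.ofBijective Φ ⟨hΦ, hsurj⟩⟩, hdeg24⟩

/-- A monic quartic over a domain is irreducible if it has no root and is not a product of two
monic quadratics. -/
theorem quartic_irreducible {R : Type*} [CommRing R] [IsDomain R] {a b c d : R}
    (hroot : ∀ x : R, x ^ 4 + a * x ^ 3 + b * x ^ 2 + c * x + d ≠ 0)
    (hquad : ∀ u v w z : R, ¬ (a = u + w ∧ b = v + z + u * w ∧ c = u * z + v * w ∧ d = v * z)) :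
    Irreducible (X ^ 4 + C a * X ^ 3 + C b * X ^ 2 + C c * X + C d) := by
  have hmonic : (X ^ 4 + C a * X ^ 3 + C b * X ^ 2 + C c * X + C d).Monic := by monicity!
  have hdeg : (X ^ 4 + C a * X ^ 3 + C b * X ^ 2 + C c * X + C d).natDegree = 4 := by
    compute_degree!
  rw [hmonic.irreducible_iff_natDegree', hdeg]
  refine ⟨fun h ↦ by simp [h] at hdeg, fun f g hf hg hfg hgdeg ↦ ?_⟩
  have hadd := hf.natDegree_mul hg
  rw [hfg, hdeg] at hadd
  rw [Finset.mem_Ioc] at hgdeg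
  obtain h1 | h2 : g.natDegree = 1 ∨ g.natDegree = 2 := by omega
  · refine hroot (-g.coeff 0) ?_
    have := congrArg (eval (-g.coeff 0)) hfg
    rw [hg.eq_X_add_C h1] at this
    simpa using this.symm
  · have hquadratic {q : R[X]} (hq : q.Monic) (hq2 : q.natDegree = 2) :
        q = X ^ 2 + C (q.coeff 1) * X + C (q.coeff 0) := by
      conv_lhs => rw [hq.as_sum, hq2]
      simp [Finset.sum_range_succ]
      ring
    refine hquad (f.coeff 1) (f.coeff 0) (g.coeff 1) (g.coeff 0) (quartic_coeff_eq ?_)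
    rw [← hfg]
    conv_lhs => rw [hquadratic hf (by omega), hquadratic hg h2]
    simp only [map_add, map_mul]
    ring

end Quartic

/-- A monic integer polynomial which is irreducible modulo a prime is irreducible over `ℚ`. -/
theorem irreducible_map_rat_of_irreducible_map_zmod {f : ℤ[X]} (hf : f.Monic) (n : ℕ)
    [Fact n.Prime] (h : Irreducible (f.map (Int.castRingHom (ZMod n)))) :
    Irreducible (f.map (Int.castRingHom ℚ)) :=
  (IsPrimitive.Int.irreducible_iff_irreducible_map_cast hf.isPrimitive).mp
    (hf.irreducible_of_irreducible_map _ _ h)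

instance fact_prime_five : Fact (Nat.Prime 5) := ⟨by norm_num⟩

/-- **Galois group of the anomalous factor.**
The Galois group of `f_anom = X⁴ - 5X³ - 29X² + 47X + 42` over `ℚ` (the Galois
group of its splitting field over `ℚ`) is isomorphic to `S₄`; in particular the
splitting field has degree `24` over `ℚ`. -/
theorem anomalous_factor_galois_group :
    Nonempty ((X ^ 4 - 5 * X ^ 3 - 29 * X ^ 2 + 47 * X + 42 : ℚ[X]).Gal ≃*
        Equiv.Perm (Fin 4)) ∧
      Module.finrank ℚ
        (X ^ 4 - 5 * X ^ 3 - 29 * X ^ 2 + 47 * X + 42 : ℚ[X]).SplittingField = 24 := by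
  have hp : (X ^ 4 - 5 * X ^ 3 - 29 * X ^ 2 + 47 * X + 42 : ℚ[X]) =
      X ^ 4 + C (-5) * X ^ 3 + C (-29) * X ^ 2 + C 47 * X + C 42 := by
    simp only [map_neg, map_ofNat]
    ring
  refine quartic_gal_mulEquiv_perm hp ?_ ?_ ?_
  · have hf := irreducible_map_rat_of_irreducible_map_zmod
      (f := X ^ 4 + C (-5) * X ^ 3 + C (-29) * X ^ 2 + C 47 * X + C 42) (by monicity!) 5 (by
        simp only [Polynomial.map_add, Polynomial.map_mul, Polynomial.map_pow, map_X, map_C]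
        exact quartic_irreducible (by decide) (by decide))
    convert hf using 1
    rw [hp]
    simp only [Polynomial.map_add, Polynomial.map_mul, Polynomial.map_pow, map_X, map_C]
    norm_num
  · have hf := irreducible_map_rat_of_irreducible_map_zmod
      (f := X ^ 3 + C 29 * X ^ 2 + C (-403) * X + C (-8131)) (by monicity!) 3 (by
        simp only [Polynomial.map_add, Polynomial.map_mul, Polynomial.map_pow, map_X, map_C]
        refine irreducible_of_degree_le_three_of_not_isRoot ?_ ?_
        · rw [Finset.mem_Icc]
          have : (X ^ 3 + C (Int.castRingHom (ZMod 3) 29) * X ^ 2 +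
            C (Int.castRingHom (ZMod 3) (-403)) * X +
            C (Int.castRingHom (ZMod 3) (-8131))).natDegree = 3 := by compute_degree!
          omega
        · simp only [IsRoot, eval_add, eval_mul, eval_pow, eval_X, eval_C]
          decide)
    convert hf using 1
    simp only [resolventCubic, Polynomial.map_add, Polynomial.map_mul, Polynomial.map_pow, map_X,
      map_C]
    norm_num
  · rw [show quarticDiscr (-5 : ℚ) (-29) 47 42 = (1117047712 : ℕ) by norm_num [quarticDiscr],
      Rat.isSquare_natCast_iff]
    rintro ⟨n, hn⟩
    have h1 : 33422 < n := by nlinarith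
    have h2 : n < 33423 := by nlinarith
    omega
end

section
/- Let K = ℚ(cos(2π/7)) be the subfield of ℝ generated over ℚ by cos(2π/7). Then the image of f_cyc = X⁶ + 2X⁵ − 9X⁴ − 7X³ + 24X² + X − 13 in K[X] factors as a product of three monic quadratic polynomials: there exist monic q₁, q₂, q₃ ∈ K[X], each of degree 2, with f_cyc = q₁·q₂·q₃ in K[X]. -/
open Real Polynomial

/-- `2 cos(2π/7)` is a root of `X³ + X² - 2X - 1`. -/
theorem two_mul_cos_two_pi_div_seven_cubic :
    (2 * Real.cos (2 * Real.pi / 7)) ^ 3 + (2 * Real.cos (2 * Real.pi / 7)) ^ 2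
      - 2 * (2 * Real.cos (2 * Real.pi / 7)) - 1 = 0 := by
  set x := 2 * Real.pi / 7 with hx
  have hlt : Real.cos x < 1 := by
    have h := Real.cos_lt_cos_of_nonneg_of_le_pi le_rfl
      (by rw [hx]; linarith [Real.pi_pos] : x ≤ Real.pi) (by positivity)
    rwa [Real.cos_zero] at h
  have h34 : Real.cos (3 * x) = Real.cos (2 * (2 * x)) := by
    rw [← Real.cos_two_pi_sub, hx]
    ring_nf
  rw [Real.cos_three_mul, Real.cos_two_mul, Real.cos_two_mul] at h34
  refine (mul_eq_zero.mp ?_).resolve_left (sub_ne_zero.mpr hlt.ne)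
  linear_combination -h34

theorem sextic_eq_prod_quadratics_of_cubic {R : Type*} [CommRing R] {t : R}
    (ht : t ^ 3 + t ^ 2 - 2 * t - 1 = 0) :
    (X ^ 6 + 2 * X ^ 5 - 9 * X ^ 4 - 7 * X ^ 3 + 24 * X ^ 2 + X - 13 : R[X]) =
      (X ^ 2 + C (t ^ 2 - 1) * X + C (-t ^ 2 - 1)) * (X ^ 2 + C (t + 1) * X + C (-t - 3)) *
        (X ^ 2 + C (-t ^ 2 - t + 2) * X + C (t ^ 2 + t - 4)) := by
  have h : (C t : R[X]) ^ 3 + C t ^ 2 - 2 * C t - 1 = 0 := by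
    simpa only [map_add, map_sub, map_mul, map_pow, map_one, map_ofNat, map_zero] using
      congrArg (C : R → R[X]) ht
  simp only [map_add, map_sub, map_neg, map_pow, map_one, map_ofNat]
  generalize (C t : R[X]) = s at h ⊢
  grind

/-- **The cyclotomic factor splits into three quadratics over `K = ℚ(cos(2π/7))`.**
Let `K` be the subfield of `ℝ` generated over `ℚ` by `cos(2π/7)`.  Then the image
of `f_cyc = X⁶ + 2X⁵ - 9X⁴ - 7X³ + 24X² + X - 13` in `K[X]` is a product of three
monic quadratic polynomials. -/
theorem cyclotomic_factor_splits_over_K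
    (K : IntermediateField ℚ ℝ)
    (hK : K = IntermediateField.adjoin ℚ ({Real.cos (2 * Real.pi / 7)} : Set ℝ)) :
    ∃ q₁ q₂ q₃ : Polynomial K,
      q₁.Monic ∧ q₂.Monic ∧ q₃.Monic ∧
      q₁.degree = 2 ∧ q₂.degree = 2 ∧ q₃.degree = 2 ∧
      Polynomial.map (algebraMap ℚ K)
          (X ^ 6 + 2 * X ^ 5 - 9 * X ^ 4 - 7 * X ^ 3 + 24 * X ^ 2 + X - 13 : ℚ[X]) =
        q₁ * q₂ * q₃ := by
  have hmem : 2 * Real.cos (2 * Real.pi / 7) ∈ K :=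
    mul_mem (ofNat_mem K 2)
      (hK ▸ IntermediateField.mem_adjoin_simple_self ℚ (Real.cos (2 * Real.pi / 7)))
  obtain ⟨t, ht⟩ : ∃ t : K, t ^ 3 + t ^ 2 - 2 * t - 1 = 0 :=
    ⟨⟨_, hmem⟩, Subtype.ext two_mul_cos_two_pi_div_seven_cubic⟩
  refine ⟨X ^ 2 + C (t ^ 2 - 1) * X + C (-t ^ 2 - 1), X ^ 2 + C (t + 1) * X + C (-t - 3),
    X ^ 2 + C (-t ^ 2 - t + 2) * X + C (t ^ 2 + t - 4),
    by monicity!, by monicity!, by monicity!,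
    by compute_degree!, by compute_degree!, by compute_degree!, ?_⟩
  rw [← sextic_eq_prod_quadratics_of_cubic ht]
  simp
end
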